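/- Let X ⊆ ℝ be a measurable set, λ a σ-finite measure on ℝ supported in X, and g : X × ℝ → [0,∞) a measurable family of nonnegative functions such that for all θ ≤ θ' in X and all x ≤ y in ℝ, g(θ,y)·g(θ',x) ≤ g(θ,x)·g(θ',y). Let φ₀, φ₁ : X → [0,∞) be measurable and satisfy φ₀(θ')·φ₁(θ) ≤ φ₀(θ)·φ₁(θ') for all θ ≤ θ' in X. Assume that for each x ∈ ℝ and i ∈ {0,1} the function θ ↦ g(θ,x)·φᵢ(θ) is λ-integrable. Define the mixtures wᵢ(x) = ∫_X g(θ,x)·φᵢ(θ) dλ(θ). Then for all x ≤ y in ℝ, w₁(x)·w₀(y) ≤ w₀(x)·w₁(y). -/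

import Mathlib

open MeasureTheory

/-- A comparison of symmetrized products integrates to a comparison of products of integrals. -/
theorem integral_mul_integral_le_of_ae_symm_le {α : Type*} [MeasurableSpace α]
    {μ : Measure α} [SFinite μ] {a b c d : α → ℝ}
    (ha : Integrable a μ) (hb : Integrable b μ) (hc : Integrable c μ) (hd : Integrable d μ)
    (h : ∀ᵐ p ∂μ.prod μ, a p.1 * b p.2 + b p.1 * a p.2 ≤ c p.1 * d p.2 + d p.1 * c p.2) :
    (∫ s, a s ∂μ) * ∫ s, b s ∂μ ≤ (∫ s, c s ∂μ) * ∫ s, d s ∂μ := by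
  have key := integral_mono_ae ((ha.mul_prod hb).add (hb.mul_prod ha))
    ((hc.mul_prod hd).add (hd.mul_prod hc)) h
  rw [integral_add' (ha.mul_prod hb) (hb.mul_prod ha),
    integral_add' (hc.mul_prod hd) (hd.mul_prod hc)] at key
  simp only [integral_prod_mul] at key
  linarith

/-- Two pairs of functions with likelihood ratios monotone in the same direction. -/
theorem symm_mul_le_of_likelihood_ratio {α : Type*} [LinearOrder α] {S : Set α}
    {u v φ ψ : α → ℝ}
    (huv : ∀ s ∈ S, ∀ t ∈ S, s ≤ t → v s * u t ≤ u s * v t)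
    (hφψ : ∀ s ∈ S, ∀ t ∈ S, s ≤ t → φ t * ψ s ≤ φ s * ψ t)
    {s t : α} (hs : s ∈ S) (ht : t ∈ S) :
    u s * ψ s * (v t * φ t) + v s * φ s * (u t * ψ t) ≤
      u s * φ s * (v t * ψ t) + v s * ψ s * (u t * φ t) := by
  rcases le_total s t with hst | hst
  · linarith [mul_nonneg (sub_nonneg.2 (huv s hs t ht hst)) (sub_nonneg.2 (hφψ s hs t ht hst))]
  · linarith [mul_nonneg (sub_nonneg.2 (huv t ht s hs hst)) (sub_nonneg.2 (hφψ t ht s hs hst))]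

/-- Lemma 1 (Theorem 1.C.11 of Shaked–Shanthikumar): likelihood-ratio ordering
is preserved under mixtures. -/
theorem mixture_likelihood_ratio_order
    (X : Set ℝ) (hX : MeasurableSet X)
    (lam : Measure ℝ) [SigmaFinite lam] (hsupp : lam Xᶜ = 0)
    (g : ℝ → ℝ → ℝ)
    (hg_meas : Measurable (Function.uncurry g))
    (hg_nonneg : ∀ θ ∈ X, ∀ x : ℝ, 0 ≤ g θ x)
    (hg_lr : ∀ θ ∈ X, ∀ θ' ∈ X, θ ≤ θ' →
      ∀ x y : ℝ, x ≤ y → g θ y * g θ' x ≤ g θ x * g θ' y)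
    (φ₀ φ₁ : ℝ → ℝ)
    (hφ₀_meas : Measurable φ₀) (hφ₁_meas : Measurable φ₁)
    (hφ₀_nonneg : ∀ θ ∈ X, 0 ≤ φ₀ θ) (hφ₁_nonneg : ∀ θ ∈ X, 0 ≤ φ₁ θ)
    (hφ_lr : ∀ θ ∈ X, ∀ θ' ∈ X, θ ≤ θ' → φ₀ θ' * φ₁ θ ≤ φ₀ θ * φ₁ θ')
    (hint0 : ∀ x : ℝ, Integrable (fun θ => g θ x * φ₀ θ) lam)
    (hint1 : ∀ x : ℝ, Integrable (fun θ => g θ x * φ₁ θ) lam)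
    (w₀ w₁ : ℝ → ℝ)
    (hw₀ : ∀ x : ℝ, w₀ x = ∫ θ in X, g θ x * φ₀ θ ∂lam)
    (hw₁ : ∀ x : ℝ, w₁ x = ∫ θ in X, g θ x * φ₁ θ ∂lam) :
    ∀ x y : ℝ, x ≤ y → w₁ x * w₀ y ≤ w₀ x * w₁ y := by
  intro x y hxy
  rw [hw₀, hw₁, hw₀, hw₁]
  refine integral_mul_integral_le_of_ae_symm_le (hint1 x).restrict (hint0 y).restrict
    (hint0 x).restrict (hint1 y).restrict ?_
  rw [Measure.prod_restrict]
  filter_upwards [ae_restrict_mem (hX.prod hX)] with p hp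
  exact symm_mul_le_of_likelihood_ratio (u := fun θ => g θ x) (v := fun θ => g θ y)
    (fun s hs t ht hst => hg_lr s hs t ht hst x y hxy) hφ_lr hp.1 hp.2
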